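/- For all n ≥ 0, the number of permutations of {1,...,n} avoiding the patterns 132, 2341, 3241, and 4123 equals F_{n+4} - 2n - 2, where F_k is the k-th Fibonacci number (F_0 = 0, F_1 = 1). -/

import Mathlib

/-- A function `π : Fin n → Fin n` contains the pattern `p : Fin k → ℕ` if there is a
strictly increasing choice of indices whose images under `π` have the same pairwise
order relations as the entries of `p`. -/
def Contains {n k : ℕ} (π : Fin n → Fin n) (p : Fin k → ℕ) : Prop :=
  ∃ f : Fin k → Fin n, StrictMono f ∧ ∀ i j, p i < p j ↔ π (f i) < π (f j)

/-- `π` avoids the pattern `p`. -/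
def Avoids {n k : ℕ} (π : Fin n → Fin n) (p : Fin k → ℕ) : Prop := ¬ Contains π p

/-- The set of permutations of `Fin n` avoiding the patterns 132, 2341 and 3241,
i.e. the 132-avoiding two-stack sortable permutations. -/
def TSS132 (n : ℕ) : Set (Fin n → Fin n) :=
  {π | Function.Bijective π ∧ Avoids π ![1,3,2] ∧ Avoids π ![2,3,4,1] ∧ Avoids π ![3,2,4,1]}

/-- The Pell numbers. -/
def pell : ℕ → ℕ
  | 0 => 0
  | 1 => 1
  | n+2 => 2 * pell (n+1) + pell n

theorem avoids_132_iff {n : ℕ} (π : Fin n → Fin n) :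
    Avoids π ![1,3,2] ↔ ∀ i j k, i < j → j < k → π i < π k → ¬ π k < π j := by
  constructor
  · intro h i j k hij hjk hik hkj
    refine h ⟨![i, j, k], ?_, ?_⟩
    · simp [Fin.strictMono_iff_lt_succ, Fin.forall_fin_succ, hij, hjk]
    · simp [Fin.forall_fin_succ, hik, hkj, hik.trans hkj, hik.le, hkj.le, (hik.trans hkj).le]
  · rintro h ⟨f, hf, hp⟩
    exact h (f 0) (f 1) (f 2) (hf (by decide)) (hf (by decide))
      ((hp 0 2).1 (by simp)) ((hp 2 1).1 (by simp))

theorem avoids_four_iff {n : ℕ} (π : Fin n → Fin n) (p : Fin 4 → ℕ) (τ : Equiv.Perm (Fin 4))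
    (hp : StrictMono (p ∘ τ)) :
    Avoids π p ↔ ∀ f : Fin 4 → Fin n, f 0 < f 1 → f 1 < f 2 → f 2 < f 3 →
      π (f (τ 0)) < π (f (τ 1)) → π (f (τ 1)) < π (f (τ 2)) → ¬ π (f (τ 2)) < π (f (τ 3)) := by
  constructor
  · intro h f h1 h2 h3 k1 k2 k3
    have hmono : StrictMono (π ∘ f ∘ τ) := by
      simp [Fin.strictMono_iff_lt_succ, Fin.forall_fin_succ, k1, k2, k3]
    refine h ⟨f, ?_, ?_⟩
    · simp [Fin.strictMono_iff_lt_succ, Fin.forall_fin_succ, h1, h2, h3]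
    · intro i j
      obtain ⟨i, rfl⟩ := τ.surjective i
      obtain ⟨j, rfl⟩ := τ.surjective j
      exact hp.lt_iff_lt.trans hmono.lt_iff_lt.symm
  · rintro h ⟨f, hf, hq⟩
    exact h f (hf (by decide)) (hf (by decide)) (hf (by decide)) ((hq _ _).1 (hp (by decide)))
      ((hq _ _).1 (hp (by decide))) ((hq _ _).1 (hp (by decide)))

theorem avoids_2341_iff {n : ℕ} (π : Fin n → Fin n) :
    Avoids π ![2,3,4,1] ↔ ∀ i j k l, i < j → j < k → k < l →
      π l < π i → π i < π j → ¬ π j < π k := by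
  rw [avoids_four_iff π _ ⟨![3,0,1,2], ![1,2,3,0], by decide, by decide⟩ (by
    simp [Fin.strictMono_iff_lt_succ, Fin.forall_fin_succ])]
  exact ⟨fun h i j k l => h ![i, j, k, l], fun h f => h _ _ _ _⟩

theorem avoids_3241_iff {n : ℕ} (π : Fin n → Fin n) :
    Avoids π ![3,2,4,1] ↔ ∀ i j k l, i < j → j < k → k < l →
      π l < π j → π j < π i → ¬ π i < π k := by
  rw [avoids_four_iff π _ ⟨![3,1,0,2], ![2,1,3,0], by decide, by decide⟩ (by
    simp [Fin.strictMono_iff_lt_succ, Fin.forall_fin_succ])]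
  exact ⟨fun h i j k l => h ![i, j, k, l], fun h f => h _ _ _ _⟩

theorem avoids_4123_iff {n : ℕ} (π : Fin n → Fin n) :
    Avoids π ![4,1,2,3] ↔ ∀ i j k l, i < j → j < k → k < l →
      π j < π k → π k < π l → ¬ π l < π i := by
  rw [avoids_four_iff π _ ⟨![1,2,3,0], ![3,0,1,2], by decide, by decide⟩ (by
    simp [Fin.strictMono_iff_lt_succ, Fin.forall_fin_succ])]
  exact ⟨fun h i j k l => h ![i, j, k, l], fun h f => h _ _ _ _⟩

/-- Injective maps avoiding 132, 2341 and 3241, in terms of inequalities between values. -/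
def IsStackSortable132 {n : ℕ} (π : Fin n → Fin n) : Prop :=
  (∀ i j, π i = π j → i = j) ∧
  (∀ i j k, i < j → j < k → π i < π k → ¬ π k < π j) ∧
  (∀ i j k l, i < j → j < k → k < l → π l < π i → π i < π j → ¬ π j < π k) ∧
  (∀ i j k l, i < j → j < k → k < l → π l < π j → π j < π i → ¬ π i < π k)

instance {n : ℕ} (π : Fin n → Fin n) : Decidable (IsStackSortable132 π) :=
  @instDecidableAnd _ _ inferInstance <| @instDecidableAnd _ _ inferInstance <|
    @instDecidableAnd _ _ inferInstance inferInstance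

/-- The condition of avoiding 4123, in terms of inequalities between values. -/
def No4123 {n : ℕ} (π : Fin n → Fin n) : Prop :=
  ∀ i j k l, i < j → j < k → k < l → π j < π k → π k < π l → ¬ π l < π i

instance {n : ℕ} (π : Fin n → Fin n) : Decidable (No4123 π) := by
  unfold No4123; infer_instance

/-- The condition of avoiding 123, in terms of inequalities between values. -/
def No123 {n : ℕ} (π : Fin n → Fin n) : Prop :=
  ∀ i j k, i < j → j < k → π i < π j → ¬ π j < π k

instance {n : ℕ} (π : Fin n → Fin n) : Decidable (No123 π) := by
  unfold No123; infer_instance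

/-- Append a new maximum at the end. -/
def appendMax {n : ℕ} (σ : Fin n → Fin n) : Fin (n+1) → Fin (n+1) :=
  Fin.snoc (α := fun _ => Fin (n+1)) (fun i => (σ i).castSucc) (Fin.last n)

/-- Prepend a new maximum. -/
def consMax {n : ℕ} (σ : Fin n → Fin n) : Fin (n+1) → Fin (n+1) :=
  Fin.cons (Fin.last n) (fun i => (σ i).castSucc)

/-- Prepend two new maximal values in increasing order. -/
def consTwoMax {n : ℕ} (σ : Fin n → Fin n) : Fin (n+2) → Fin (n+2) :=
  Fin.cons (Fin.last n).castSucc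
    (Fin.cons (Fin.last (n+1)) (fun i => (σ i).castSucc.castSucc) : Fin (n+1) → Fin (n+2))

theorem isStackSortable132_appendMax {n : ℕ} (σ : Fin n → Fin n) :
    IsStackSortable132 (appendMax σ) ↔ IsStackSortable132 σ := by
  have h := fun i : Fin n => (Fin.castSucc_lt_last i).ne
  have h' := fun i : Fin n => (Fin.castSucc_lt_last i).ne'
  have h2 := fun i : Fin n => (Fin.castSucc_lt_last i).not_gt
  simp [IsStackSortable132, appendMax, Fin.forall_fin_succ', Fin.castSucc_lt_last, h, h', h2, Fin.le_last]

theorem no4123_appendMax {n : ℕ} (σ : Fin n → Fin n) :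
    No4123 (appendMax σ) ↔ No4123 σ := by
  have h2 := fun i : Fin n => (Fin.castSucc_lt_last i).not_gt
  simp [No4123, appendMax, Fin.forall_fin_succ', h2, Fin.le_last]

theorem isStackSortable132_consMax {n : ℕ} (σ : Fin n → Fin n) :
    IsStackSortable132 (consMax σ) ↔ IsStackSortable132 σ := by
  have h := fun i : Fin n => (Fin.castSucc_lt_last i).ne
  have h' := fun i : Fin n => (Fin.castSucc_lt_last i).ne'
  have h2 := fun i : Fin n => (Fin.castSucc_lt_last i).not_gt
  simp [IsStackSortable132, consMax, Fin.forall_fin_succ, Fin.castSucc_lt_last, h, h', h2, Fin.le_last]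

theorem no123_consMax {n : ℕ} (σ : Fin n → Fin n) :
    No123 (consMax σ) ↔ No123 σ := by
  have h2 := fun i : Fin n => (Fin.castSucc_lt_last i).not_gt
  simp [No123, consMax, Fin.forall_fin_succ, h2, Fin.le_last]

theorem no4123_of_no123 {n : ℕ} {σ : Fin n → Fin n} (h : No123 σ) : No4123 σ :=
  fun _ j k l _ hjk hkl h1 h2 _ => h j k l hjk hkl h1 h2

theorem no4123_consMax {n : ℕ} (σ : Fin n → Fin n) :
    No4123 (consMax σ) ↔ No123 σ := by
  refine ⟨fun h i j k hij hjk h1 h2 => ?_, fun h =>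
    no4123_of_no123 ((no123_consMax σ).2 h)⟩
  exact h 0 i.succ j.succ k.succ (Fin.succ_pos i) (by simpa) (by simpa) (by simpa [consMax])
    (by simpa [consMax]) (by simp [consMax, Fin.castSucc_lt_last])

theorem isStackSortable132_consTwoMax {n : ℕ} (σ : Fin n → Fin n) :
    IsStackSortable132 (consTwoMax σ) ↔ IsStackSortable132 σ := by
  have h := fun i : Fin (n+1) => (Fin.castSucc_lt_last i).ne
  have h' := fun i : Fin (n+1) => (Fin.castSucc_lt_last i).ne'
  have h2 := fun i : Fin (n+1) => (Fin.castSucc_lt_last i).not_gt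
  have k := fun i : Fin n => (Fin.castSucc_lt_last i).ne
  have k' := fun i : Fin n => (Fin.castSucc_lt_last i).ne'
  have k2 := fun i : Fin n => (Fin.castSucc_lt_last i).not_gt
  simp [IsStackSortable132, consTwoMax, Fin.forall_fin_succ, Fin.castSucc_lt_last, h, h', h2, k, k',
    k2, Fin.le_last, -Fin.succ_zero_eq_one]

theorem no123_consTwoMax {n : ℕ} (σ : Fin n → Fin n) :
    No123 (consTwoMax σ) ↔ No123 σ := by
  have h2 := fun i : Fin (n+1) => (Fin.castSucc_lt_last i).not_gt
  have k2 := fun i : Fin n => (Fin.castSucc_lt_last i).not_gt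
  simp [No123, consTwoMax, Fin.forall_fin_succ, h2, k2, Fin.le_last,
    -Fin.succ_zero_eq_one]

theorem no4123_consTwoMax {n : ℕ} (σ : Fin n → Fin n) :
    No4123 (consTwoMax σ) ↔ No123 σ := by
  refine ⟨fun h i j k hij hjk h1 h2 => ?_, fun h =>
    no4123_of_no123 ((no123_consTwoMax σ).2 h)⟩
  exact h 0 i.succ.succ j.succ.succ k.succ.succ (Fin.succ_pos _) (by simpa) (by simpa)
    (by simpa [consTwoMax]) (by simpa [consTwoMax]) (by simp [consTwoMax, Fin.castSucc_lt_last])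

theorem exists_eq_castSucc {ι : Type*} {n : ℕ} {f : ι → Fin (n+1)} (h : ∀ i, f i ≠ Fin.last n) :
    ∃ σ : ι → Fin n, ∀ i, f i = (σ i).castSucc :=
  ⟨fun i => (f i).castPred (h i), fun i => by simp⟩

theorem IsStackSortable132.eq_appendMax_or_consMax_or_consTwoMax {n : ℕ}
    {π : Fin (n+2) → Fin (n+2)} (h : IsStackSortable132 π) :
    (∃ σ, appendMax σ = π) ∨ (∃ σ, consMax σ = π) ∨ ∃ σ : Fin n → Fin n, consTwoMax σ = π := by
  obtain ⟨hinj, h132, h2341, h3241⟩ := h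
  have hsurj : Function.Surjective π := Finite.injective_iff_surjective.1 fun i j => hinj i j
  have hne : ∀ i j, i ≠ j → π i ≠ π j := fun i j hij h => hij (hinj i j h)
  obtain ⟨p, hp⟩ := hsurj (Fin.last _)
  have hlt : ∀ i, i ≠ p → π i < Fin.last _ := fun i hi =>
    Fin.lt_last_iff_ne_last.2 (hp ▸ hne i p hi)
  by_cases hpl : p = Fin.last _
  · subst hpl
    obtain ⟨σ, hσ⟩ := exists_eq_castSucc (f := fun i => π (Fin.castSucc i))
      fun i => (hlt _ (Fin.castSucc_lt_last i).ne).ne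
    refine Or.inl ⟨σ, funext fun i => ?_⟩
    cases i using Fin.lastCases <;> simp [appendMax, hp, hσ]
  obtain rfl | ⟨q, rfl⟩ := Fin.eq_zero_or_eq_succ p
  · obtain ⟨σ, hσ⟩ := exists_eq_castSucc (f := fun i => π (Fin.succ i))
      fun i => (hlt _ (Fin.succ_ne_zero i)).ne
    refine Or.inr (Or.inl ⟨σ, funext fun i => ?_⟩)
    cases i using Fin.cases <;> simp [consMax, hp, hσ]
  have hdrop : ∀ i j, i < q.succ → q.succ < j → π j < π i := fun i j hi hj =>
    (not_lt.1 fun hij => h132 i _ j hi hj hij (hp ▸ hlt j hj.ne')).lt_of_ne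
      (hne _ _ (hi.trans hj).ne')
  obtain rfl | ⟨r, rfl⟩ := Fin.eq_zero_or_eq_succ q
  · have h0 : π 0 = (Fin.last n).castSucc := by
      obtain ⟨s, hs⟩ := hsurj (Fin.last n).castSucc
      rcases lt_trichotomy s (Fin.succ 0) with hlts | rfl | hgts
      · rwa [show s = 0 from Fin.lt_one_iff s |>.1 hlts] at hs
      · exact absurd (hs.symm.trans hp) (Fin.castSucc_lt_last _).ne
      · have h1 := hdrop 0 s (Fin.succ_pos 0) hgts
        have h2 := hlt 0 (Fin.succ_pos 0).ne
        simp only [hs, Fin.lt_def, Fin.val_castSucc, Fin.val_last] at h1 h2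
        omega
    have hsmall : ∀ i : Fin n, (π i.succ.succ : ℕ) < n := fun i => by
      have h1 := hdrop 0 i.succ.succ (Fin.succ_pos 0) (Fin.succ_lt_succ_iff.2 (Fin.succ_pos i))
      simpa [h0, Fin.lt_def] using h1
    refine Or.inr (Or.inr ⟨fun i => ⟨_, hsmall i⟩, funext fun i => ?_⟩)
    cases i using Fin.cases with
    | zero => simp [consTwoMax, h0]
    | succ i => cases i using Fin.cases with
      | zero => simpa [consTwoMax] using hp.symm
      | succ i => simp [consTwoMax]
  · have hl : r.succ.succ < Fin.last (n+1) := Fin.lt_last_iff_ne_last.2 hpl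
    have h01 : (0 : Fin (n+2)) < Fin.succ 0 := Fin.succ_pos 0
    have h1p : Fin.succ 0 < r.succ.succ := Fin.succ_lt_succ_iff.2 (Fin.succ_pos r)
    have hmax : ∀ i, i < r.succ.succ → π i < π r.succ.succ := fun i hi => hp ▸ hlt i hi.ne
    rcases lt_trichotomy (π 0) (π (Fin.succ 0)) with hlt' | heq | hgt
    · exact (h2341 _ _ _ _ h01 h1p hl (hdrop _ _ (h01.trans h1p) hl) hlt' (hmax _ h1p)).elim
    · exact (hne _ _ h01.ne heq).elim
    · exact (h3241 _ _ _ _ h01 h1p hl (hdrop _ _ h1p hl) hgt (hmax _ (h01.trans h1p))).elim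

theorem appendMax_injective (n : ℕ) : Function.Injective (appendMax (n := n)) := fun σ τ h =>
  funext fun i => by simpa [appendMax] using congrFun h i.castSucc

theorem consMax_injective (n : ℕ) : Function.Injective (consMax (n := n)) := fun σ τ h =>
  funext fun i => by simpa [consMax] using congrFun h i.succ

theorem consTwoMax_injective (n : ℕ) : Function.Injective (consTwoMax (n := n)) := fun σ τ h =>
  funext fun i => by simpa [consTwoMax] using congrFun h i.succ.succ

theorem appendMax_ne_consMax {n : ℕ} (σ τ : Fin (n+1) → Fin (n+1)) :
    appendMax σ ≠ consMax τ := fun h =>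
  (Fin.castSucc_lt_last (σ 0)).ne <| by
    have h0 := congrFun h (Fin.castSucc 0)
    rwa [appendMax, Fin.snoc_castSucc, Fin.castSucc_zero, consMax, Fin.cons_zero] at h0

theorem consMax_ne_consTwoMax {n : ℕ} (σ : Fin (n+1) → Fin (n+1)) (τ : Fin n → Fin n) :
    consMax σ ≠ consTwoMax τ := fun h =>
  (Fin.castSucc_lt_last (Fin.last n)).ne' <| by simpa [consMax, consTwoMax] using congrFun h 0

theorem appendMax_ne_consTwoMax {n : ℕ} (σ : Fin (n+2) → Fin (n+2)) (τ : Fin (n+1) → Fin (n+1)) :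
    appendMax σ ≠ consTwoMax τ := fun h =>
  (Fin.castSucc_lt_last (σ (Fin.succ 0))).ne <| by
    have h0 := congrFun h (Fin.castSucc (Fin.succ 0))
    rwa [appendMax, Fin.snoc_castSucc, Fin.castSucc_succ, Fin.castSucc_zero, consTwoMax,
      Fin.cons_succ, Fin.cons_zero] at h0

theorem no123_appendMax_iff {n : ℕ} {σ : Fin n → Fin n} (hσ : IsStackSortable132 σ) :
    No123 (appendMax σ) ↔ σ = Fin.rev := by
  have h2 := fun i : Fin n => (Fin.castSucc_lt_last i).not_gt
  constructor
  · intro h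
    have hanti : StrictAnti σ := fun i j hij => (not_lt.1 fun hlt =>
      h i.castSucc j.castSucc (Fin.last n) (by simpa) (Fin.castSucc_lt_last j)
        (by simpa [appendMax]) (by simp [appendMax, Fin.castSucc_lt_last])).lt_of_ne
          fun he => hij.ne' (hσ.1 _ _ he)
    have hid : Fin.rev ∘ σ = id := StrictMono.eq_id (Fin.rev_strictAnti.comp hanti)
    exact funext fun i => Fin.rev_injective (by simpa using congrFun hid i)
  · rintro rfl
    simp only [No123, appendMax, Fin.forall_fin_succ']
    simp [h2]
    grind

theorem isStackSortable132_rev (n : ℕ) : IsStackSortable132 (Fin.rev : Fin n → Fin n) := by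
  simp only [IsStackSortable132, Fin.rev_lt_rev, Fin.rev_inj]
  refine ⟨fun _ _ => id, ?_, ?_, ?_⟩ <;> intros <;> order

theorem ncard_union_three_images {α β γ δ : Type*} [Finite δ] {f : α → δ} {g : β → δ} {h : γ → δ}
    (hf : f.Injective) (hg : g.Injective) (hh : h.Injective) (hfg : ∀ a b, f a ≠ g b)
    (hfh : ∀ a c, f a ≠ h c) (hgh : ∀ b c, g b ≠ h c) (s : Set α) (t : Set β) (u : Set γ) :
    (f '' s ∪ (g '' t ∪ h '' u)).ncard = s.ncard + (t.ncard + u.ncard) := by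
  rw [Set.ncard_union_eq _ (Set.toFinite _) (Set.toFinite _),
    Set.ncard_union_eq _ (Set.toFinite _) (Set.toFinite _), Set.ncard_image_of_injective _ hf,
    Set.ncard_image_of_injective _ hg, Set.ncard_image_of_injective _ hh]
  · rw [Set.disjoint_left]
    rintro _ ⟨b, _, rfl⟩ ⟨c, _, hc⟩
    exact hgh b c hc.symm
  · rw [Set.disjoint_left]
    rintro _ ⟨a, _, rfl⟩ (⟨b, _, hb⟩ | ⟨c, _, hc⟩)
    · exact hfg a b hb.symm
    · exact hfh a c hc.symm

/-- The number of permutations of `Fin n` avoiding 132, 2341, 3241 and 123. -/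
noncomputable def numNo123 (n : ℕ) : ℕ :=
  {π : Fin n → Fin n | IsStackSortable132 π ∧ No123 π}.ncard

/-- The number of permutations of `Fin n` avoiding 132, 2341, 3241 and 4123. -/
noncomputable def numNo4123 (n : ℕ) : ℕ :=
  {π : Fin n → Fin n | IsStackSortable132 π ∧ No4123 π}.ncard

theorem numNo123_add_three (n : ℕ) :
    numNo123 (n+3) = 1 + (numNo123 (n+2) + numNo123 (n+1)) := by
  have key := ncard_union_three_images (appendMax_injective (n+2)) (consMax_injective (n+2))
    (consTwoMax_injective (n+1)) appendMax_ne_consMax appendMax_ne_consTwoMax consMax_ne_consTwoMax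
    {Fin.rev} {π | IsStackSortable132 π ∧ No123 π} {π | IsStackSortable132 π ∧ No123 π}
  rw [Set.ncard_singleton] at key
  refine Eq.trans (congrArg Set.ncard ?_) key
  ext π
  constructor
  · rintro ⟨h, h'⟩
    obtain ⟨σ, rfl⟩ | ⟨σ, rfl⟩ | ⟨σ, rfl⟩ := h.eq_appendMax_or_consMax_or_consTwoMax
    · rw [isStackSortable132_appendMax] at h
      exact Or.inl ⟨σ, (no123_appendMax_iff h).1 h', rfl⟩
    · exact Or.inr (Or.inl ⟨σ, ⟨(isStackSortable132_consMax σ).1 h, (no123_consMax σ).1 h'⟩, rfl⟩)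
    · exact Or.inr (Or.inr
        ⟨σ, ⟨(isStackSortable132_consTwoMax σ).1 h, (no123_consTwoMax σ).1 h'⟩, rfl⟩)
  · rintro (⟨σ, rfl, rfl⟩ | ⟨σ, ⟨h, h'⟩, rfl⟩ | ⟨σ, ⟨h, h'⟩, rfl⟩)
    · have h := isStackSortable132_rev (n+2)
      exact ⟨(isStackSortable132_appendMax _).2 h, (no123_appendMax_iff h).2 rfl⟩
    · exact ⟨(isStackSortable132_consMax σ).2 h, (no123_consMax σ).2 h'⟩
    · exact ⟨(isStackSortable132_consTwoMax σ).2 h, (no123_consTwoMax σ).2 h'⟩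

theorem numNo4123_add_three (n : ℕ) :
    numNo4123 (n+3) = numNo4123 (n+2) + (numNo123 (n+2) + numNo123 (n+1)) := by
  refine Eq.trans (congrArg Set.ncard ?_) <| ncard_union_three_images
    (appendMax_injective (n+2)) (consMax_injective (n+2))
    (consTwoMax_injective (n+1)) appendMax_ne_consMax appendMax_ne_consTwoMax consMax_ne_consTwoMax
    {π | IsStackSortable132 π ∧ No4123 π} {π | IsStackSortable132 π ∧ No123 π}
    {π | IsStackSortable132 π ∧ No123 π}
  ext π
  constructor
  · rintro ⟨h, h'⟩
    obtain ⟨σ, rfl⟩ | ⟨σ, rfl⟩ | ⟨σ, rfl⟩ := h.eq_appendMax_or_consMax_or_consTwoMax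
    · exact Or.inl ⟨σ, ⟨(isStackSortable132_appendMax σ).1 h, (no4123_appendMax σ).1 h'⟩, rfl⟩
    · exact Or.inr (Or.inl ⟨σ, ⟨(isStackSortable132_consMax σ).1 h, (no4123_consMax σ).1 h'⟩, rfl⟩)
    · exact Or.inr (Or.inr
        ⟨σ, ⟨(isStackSortable132_consTwoMax σ).1 h, (no4123_consTwoMax σ).1 h'⟩, rfl⟩)
  · rintro (⟨σ, ⟨h, h'⟩, rfl⟩ | ⟨σ, ⟨h, h'⟩, rfl⟩ | ⟨σ, ⟨h, h'⟩, rfl⟩)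
    · exact ⟨(isStackSortable132_appendMax σ).2 h, (no4123_appendMax σ).2 h'⟩
    · exact ⟨(isStackSortable132_consMax σ).2 h, (no4123_consMax σ).2 h'⟩
    · exact ⟨(isStackSortable132_consTwoMax σ).2 h, (no4123_consTwoMax σ).2 h'⟩

theorem numNo123_add_one : ∀ n : ℕ,
    numNo123 (n+1) + 1 = Nat.fib (n+3)
  | 0 => by rw [numNo123, Set.ncard_eq_toFinset_card']; decide
  | 1 => by rw [numNo123, Set.ncard_eq_toFinset_card']; decide
  | n+2 => by
    have h1 := numNo123_add_one n
    have h2 := numNo123_add_one (n+1)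
    have h3 := numNo123_add_three n
    have h4 : Nat.fib (n+5) = Nat.fib (n+3) + Nat.fib (n+4) := Nat.fib_add_two
    simp only [add_assoc, Nat.reduceAdd] at *
    omega

theorem numNo4123_add : ∀ n : ℕ,
    numNo4123 n + 2 * n + 2 = Nat.fib (n+4)
  | 0 => by rw [numNo4123, Set.ncard_eq_toFinset_card']; decide
  | 1 => by rw [numNo4123, Set.ncard_eq_toFinset_card']; decide
  | 2 => by rw [numNo4123, Set.ncard_eq_toFinset_card']; decide
  | n+3 => by
    have h1 := numNo123_add_one n
    have h2 := numNo123_add_one (n+1)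
    have h3 := numNo4123_add (n+2)
    have h4 := numNo4123_add_three n
    have h5 : Nat.fib (n+5) = Nat.fib (n+3) + Nat.fib (n+4) := Nat.fib_add_two
    have h6 : Nat.fib (n+7) = Nat.fib (n+5) + Nat.fib (n+6) := Nat.fib_add_two
    simp only [add_assoc, Nat.reduceAdd] at *
    omega

theorem stmt_9 (n : ℕ) :
    (Nat.card ↥{π ∈ TSS132 n | Avoids π ![4,1,2,3]} : ℤ) = Nat.fib (n+4) - 2*n - 2 := by
  have hset : {π ∈ TSS132 n | Avoids π ![4,1,2,3]} =
      {π : Fin n → Fin n | IsStackSortable132 π ∧ No4123 π} := by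
    ext π
    simp only [TSS132, Set.mem_ofPred_eq, ← Finite.injective_iff_bijective, avoids_132_iff,
      avoids_2341_iff, avoids_3241_iff, avoids_4123_iff]
    rfl
  rw [hset, Nat.card_coe_set_eq, ← numNo4123]
  have h := numNo4123_add n
  omega
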